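/- Let I ⊆ R be a monomial ideal with linear quotients whose decomposition function b is regular, and let m ∈ G(I) and α ⊆ set(m). Then for any two permutations σ and σ′ of α such that ch(m,α,σ) and ch(m,α,σ′) are both nondegenerate, there exists a finite sequence of permutations σ = τ^(0), τ^(1), …, τ^(r) = σ′ of α such that every ch(m,α,τ^(i)) is nondegenerate and each τ^(i+1) is obtained from τ^(i) by transposing two adjacent entries. -/

import Mathlib

open MvPolynomial

/-- The monomial ideal generated by a set of exponent vectors. -/
noncomputable def genIdeal (K : Type*) [Field K] {n : ℕ} (ms : Set (Fin n →₀ ℕ)) :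
    Ideal (MvPolynomial (Fin n) K) :=
  Ideal.span ((fun u => MvPolynomial.monomial u (1 : K)) '' ms)

/-- The colon ideal `⟨m_1, …, m_{j-1}⟩ : m_j`. -/
noncomputable def colonJ (K : Type*) [Field K] {n k : ℕ} (m : Fin k → (Fin n →₀ ℕ))
    (j : Fin k) : Ideal (MvPolynomial (Fin n) K) :=
  Submodule.colon (genIdeal K {u | ∃ i : Fin k, i < j ∧ u = m i})
    (Ideal.span {MvPolynomial.monomial (m j) (1 : K)})

/-- `I` has linear quotients w.r.t. the ordering `m_1,…,m_k` of its generators: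
each colon ideal is generated by a subset of the variables. -/
def HasLinearQuotients (K : Type*) [Field K] {n k : ℕ}
    (m : Fin k → (Fin n →₀ ℕ)) : Prop :=
  ∀ j : Fin k, ∃ S : Set (Fin n),
    colonJ K m j = Ideal.span ((fun s => (MvPolynomial.X s : MvPolynomial (Fin n) K)) '' S)

/-- `set(m_j) = {i : x_i ∈ ⟨m_1,…,m_{j-1}⟩ : m_j}`. -/
def mset (K : Type*) [Field K] {n k : ℕ} (m : Fin k → (Fin n →₀ ℕ)) (j : Fin k) :
    Set (Fin n) :=
  {t | (MvPolynomial.X t : MvPolynomial (Fin n) K) ∈ colonJ K m j}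

/-- The `m i` are minimal monomial generators: none divides another. -/
def MinimalGens {n k : ℕ} (m : Fin k → (Fin n →₀ ℕ)) : Prop :=
  ∀ i j : Fin k, m i ≤ m j → i = j

/-- `b` is the decomposition function: for a monomial `u ∈ I`, `b u` is the smallest
index `j` with `u ∈ ⟨m_1,…,m_j⟩`. -/
def IsDecompositionFunction (K : Type*) [Field K] {n k : ℕ}
    (m : Fin k → (Fin n →₀ ℕ)) (b : (Fin n →₀ ℕ) → Fin k) : Prop :=
  ∀ u : Fin n →₀ ℕ, MvPolynomial.monomial u (1 : K) ∈ genIdeal K (Set.range m) →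
    (MvPolynomial.monomial u (1 : K) ∈ genIdeal K {v | ∃ i : Fin k, i ≤ b u ∧ v = m i}) ∧
    (∀ j : Fin k,
      MvPolynomial.monomial u (1 : K) ∈ genIdeal K {v | ∃ i : Fin k, i ≤ j ∧ v = m i} →
      b u ≤ j)

/-- The decomposition function is regular: `set(b(x_t·m)) ⊆ set(m)` for every
generator `m` and every `t ∈ set(m)`. -/
def IsRegularDecomp (K : Type*) [Field K] {n k : ℕ}
    (m : Fin k → (Fin n →₀ ℕ)) (b : (Fin n →₀ ℕ) → Fin k) : Prop :=
  ∀ j : Fin k, ∀ t ∈ mset K m j,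
    mset K m (b (m j + Finsupp.single t 1)) ⊆ mset K m j

/-- The sequence of vertex monomials `m_0 = m₀`, `m_{i+1} = b(x_{σ(i)} · m_i)` of the
simplex `ch(m, α, σ)` (here `σ` is 0-indexed: `σ 0, …, σ (p-1)` is the permutation). -/
noncomputable def chainSeq {n k : ℕ} (m : Fin k → (Fin n →₀ ℕ)) (b : (Fin n →₀ ℕ) → Fin k)
    (m0 : Fin n →₀ ℕ) (σ : ℕ → Fin n) : ℕ → (Fin n →₀ ℕ)
  | 0 => m0
  | i + 1 => m (b (chainSeq m b m0 σ i + Finsupp.single (σ i) 1))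

/-- `σ 0, …, σ (p-1)` is a permutation (an ordering) of the finite set `α`. -/
def PermOf {n : ℕ} (σ : ℕ → Fin n) (p : ℕ) (α : Finset (Fin n)) : Prop :=
  Set.InjOn σ (Set.Iio p) ∧ ∀ a : Fin n, a ∈ α ↔ ∃ i < p, σ i = a

/-- `ch(m,α,σ)` is nondegenerate: the vertex monomials `m_0, …, m_p` are pairwise
distinct. -/
def Nondeg {n k : ℕ} (m : Fin k → (Fin n →₀ ℕ)) (b : (Fin n →₀ ℕ) → Fin k)
    (m0 : Fin n →₀ ℕ) (σ : ℕ → Fin n) (p : ℕ) : Prop :=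
  Set.InjOn (chainSeq m b m0 σ) (Set.Iic p)

/-- A monomial (exponent vector) regarded as a point of `ℝⁿ`. -/
def toR {n : ℕ} (u : Fin n →₀ ℕ) : Fin n → ℝ := fun a => (u a : ℝ)

/-- The set of vertex monomials of `ch(m,α,σ)`. -/
def vertSet {n k : ℕ} (m : Fin k → (Fin n →₀ ℕ)) (b : (Fin n →₀ ℕ) → Fin k)
    (m0 : Fin n →₀ ℕ) (σ : ℕ → Fin n) (p : ℕ) : Set (Fin n →₀ ℕ) :=
  {v | ∃ i ≤ p, v = chainSeq m b m0 σ i}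

section Decomposition

variable {K : Type*} [Field K] {n k : ℕ} {m : Fin k → (Fin n →₀ ℕ)} {b : (Fin n →₀ ℕ) → Fin k}

lemma monomial_mem_genIdeal {u : Fin n →₀ ℕ} {s : Set (Fin n →₀ ℕ)} :
    monomial u (1 : K) ∈ genIdeal K s ↔ ∃ v ∈ s, v ≤ u := by
  classical
  rw [genIdeal, mem_ideal_span_monomial_image, support_monomial, if_neg one_ne_zero]
  simp

lemma monomial_mem_colonJ {u : Fin n →₀ ℕ} {j : Fin k} :
    monomial u (1 : K) ∈ colonJ K m j ↔ ∃ i < j, m i ≤ m j + u := by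
  rw [colonJ, Ideal.mem_colon_span_singleton, monomial_mul, one_mul, monomial_mem_genIdeal,
    add_comm u]
  constructor
  · rintro ⟨_, ⟨i, hi, rfl⟩, h⟩
    exact ⟨i, hi, h⟩
  · rintro ⟨i, hi, h⟩
    exact ⟨_, ⟨i, hi, rfl⟩, h⟩

lemma mem_mset {t : Fin n} {j : Fin k} :
    t ∈ mset K m j ↔ ∃ i < j, m i ≤ m j + Finsupp.single t 1 :=
  monomial_mem_colonJ

lemma HasLinearQuotients.exists_mem_mset (hlq : HasLinearQuotients K m) {i j : Fin k}
    {v : Fin n →₀ ℕ} (hij : i < j) (h : m i ≤ m j + v) : ∃ t ∈ mset K m j, v t ≠ 0 := by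
  classical
  obtain ⟨S, hS⟩ := hlq j
  have hv : monomial v (1 : K) ∈ colonJ K m j := monomial_mem_colonJ.2 ⟨i, hij, h⟩
  rw [hS] at hv
  obtain ⟨t, ht, hvt⟩ := mem_ideal_span_X_image.1 hv v (by
    rw [support_monomial, if_neg one_ne_zero]
    simp)
  refine ⟨t, ?_, hvt⟩
  change (X t : MvPolynomial (Fin n) K) ∈ colonJ K m j
  rw [hS]
  exact Ideal.subset_span ⟨t, ht, rfl⟩

namespace IsDecompositionFunction

lemma spec (hb : IsDecompositionFunction K m b) {u : Fin n →₀ ℕ} {i : Fin k} (hi : m i ≤ u) :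
    m (b u) ≤ u ∧ b u ≤ i := by
  obtain ⟨h₁, h₂⟩ := hb u (monomial_mem_genIdeal.2 ⟨_, ⟨i, rfl⟩, hi⟩)
  have least : ∀ i, m i ≤ u → b u ≤ i := fun i hi =>
    h₂ i (monomial_mem_genIdeal.2 ⟨_, ⟨i, le_rfl, rfl⟩, hi⟩)
  obtain ⟨_, ⟨i', hi', rfl⟩, hle⟩ := monomial_mem_genIdeal.1 h₁
  obtain rfl : i' = b u := le_antisymm hi' (least _ hle)
  exact ⟨hle, least i hi⟩

lemma eq_of_forall_mset (hb : IsDecompositionFunction K m b) (hlq : HasLinearQuotients K m)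
    {u : Fin n →₀ ℕ} {i : Fin k} (hi : m i ≤ u) (h : ∀ t ∈ mset K m i, u t = m i t) :
    b u = i := by
  obtain ⟨hle, hbi⟩ := hb.spec hi
  refine hbi.eq_of_not_lt fun hlt => ?_
  obtain ⟨t, ht, hne⟩ := hlq.exists_mem_mset (v := u - m i) hlt
    (by rwa [add_tsub_cancel_of_le hi])
  simp [h t ht] at hne

lemma apply_eq_of_mem_mset (hb : IsDecompositionFunction K m b) {u : Fin n →₀ ℕ} {i : Fin k}
    (hi : m i ≤ u) {t : Fin n} (ht : t ∈ mset K m (b u)) : u t = m (b u) t := by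
  have hle := (hb.spec hi).1
  by_contra hne
  obtain ⟨i', hlt, hi'⟩ := mem_mset.1 ht
  refine hlt.not_ge (hb.spec (hi'.trans fun s => ?_)).2
  have := hle s
  rcases eq_or_ne t s with rfl | hs
  · simp only [Finsupp.add_apply, Finsupp.single_eq_same]
    omega
  · simpa [Finsupp.single_apply, hs] using this

lemma eq_of_notMem_mset (hb : IsDecompositionFunction K m b) (hlq : HasLinearQuotients K m)
    {i : Fin k} {a : Fin n} (ha : a ∉ mset K m i) : b (m i + Finsupp.single a 1) = i := by
  refine hb.eq_of_forall_mset hlq le_self_add fun t ht => ?_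
  have : a ≠ t := fun h => ha (h ▸ ht)
  simp [this]

lemma lt_iff_mem_mset (hb : IsDecompositionFunction K m b) (hlq : HasLinearQuotients K m)
    {i : Fin k} {a : Fin n} : b (m i + Finsupp.single a 1) < i ↔ a ∈ mset K m i := by
  refine ⟨fun h => ?_, fun h => ?_⟩
  · by_contra ha
    exact h.ne (hb.eq_of_notMem_mset hlq ha)
  · obtain ⟨i', hlt, hi'⟩ := mem_mset.1 h
    exact (hb.spec hi').2.trans_lt hlt

lemma mset_subset (hb : IsDecompositionFunction K m b) (hlq : HasLinearQuotients K m)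
    (hreg : IsRegularDecomp K m b) (i : Fin k) (a : Fin n) :
    mset K m (b (m i + Finsupp.single a 1)) ⊆ mset K m i := by
  by_cases ha : a ∈ mset K m i
  · exact hreg i a ha
  · rw [hb.eq_of_notMem_mset hlq ha]

lemma add_single (hb : IsDecompositionFunction K m b) (hlq : HasLinearQuotients K m)
    (hreg : IsRegularDecomp K m b) {u : Fin n →₀ ℕ} {i : Fin k} (hi : m i ≤ u) (a : Fin n) :
    b (u + Finsupp.single a 1) = b (m (b u) + Finsupp.single a 1) := by
  have hle := (hb.spec hi).1
  have hself : m (b u) ≤ m (b u) + Finsupp.single a 1 := le_self_add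
  refine hb.eq_of_forall_mset hlq ((hb.spec hself).1.trans (by gcongr)) fun t ht => ?_
  rw [← hb.apply_eq_of_mem_mset hself ht, Finsupp.add_apply, Finsupp.add_apply,
    hb.apply_eq_of_mem_mset hi (hb.mset_subset hlq hreg _ _ ht)]

end IsDecompositionFunction

end Decomposition

section Feasible

variable {ι : Type*}

/-- A word, read from right to left, is feasible if each letter is allowed by the multiset of
letters preceding it. -/
def Feasible (S : Multiset ι → Set ι) : List ι → Prop
  | [] => True
  | a :: l => a ∈ S l ∧ Feasible S l

/-- `AdjSwap l l'` says that `l'` arises from `l` by transposing two adjacent entries. -/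
inductive AdjSwap : List ι → List ι → Prop
  | swap (a b : ι) (l : List ι) : AdjSwap (a :: b :: l) (b :: a :: l)
  | cons (a : ι) {l l' : List ι} : AdjSwap l l' → AdjSwap (a :: l) (a :: l')

lemma AdjSwap.perm {l l' : List ι} (h : AdjSwap l l') : l.Perm l' := by
  induction h with
  | swap a b l => exact List.Perm.swap b a l
  | cons a _ ih => exact ih.cons a

variable {S : Multiset ι → Set ι}

/-- An adjacent transposition whose result is feasible. -/
def FeasibleSwap (S : Multiset ι → Set ι) (l l' : List ι) : Prop :=
  AdjSwap l l' ∧ Feasible S l'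

lemma Feasible.sublist (hS : Antitone S) {l l' : List ι} (h : l'.Sublist l)
    (hl : Feasible S l) : Feasible S l' := by
  induction h with
  | slnil => exact hl
  | cons a _ ih => exact ih hl.2
  | cons_cons a h ih => exact ⟨hS h.subperm hl.1, ih hl.2⟩

lemma FeasibleSwap.reflTransGen_cons {a : ι} {l l' : List ι} (ha : a ∈ S l)
    (h : Relation.ReflTransGen (FeasibleSwap S) l l') :
    Relation.ReflTransGen (FeasibleSwap S) (a :: l) (a :: l') ∧ l.Perm l' := by
  induction h with
  | refl => exact ⟨.refl, .refl _⟩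
  | tail _ h ih =>
    have hp := ih.2.trans h.1.perm
    exact ⟨ih.1.tail ⟨h.1.cons a, Multiset.coe_eq_coe.2 hp ▸ ha, h.2⟩, hp⟩

/-- Any two feasible orderings of the same multiset are connected by adjacent transpositions
through feasible orderings. -/
theorem Feasible.reflTransGen [DecidableEq ι] (hS : Antitone S) :
    ∀ {l l' : List ι}, l.Perm l' → Feasible S l → Feasible S l' →
      Relation.ReflTransGen (FeasibleSwap S) l l'
  | [], l', hp, _, _ => by
    rw [hp.nil_eq]
  | c :: t, [], hp, _, _ => by simp at hp
  | c :: t, a :: t', hp, hl, hl' => by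
    rcases eq_or_ne a c with rfl | hac
    · exact (FeasibleSwap.reflTransGen_cons hl.1
        (Feasible.reflTransGen hS hp.cons_inv hl.2 hl'.2)).1
    · have hat : a ∈ t := by
        have : a ∈ c :: t := hp.symm.subset List.mem_cons_self
        simpa [hac] using this
      have htw : t.Perm (a :: t.erase a) := List.perm_cons_erase hat
      have htw' : t'.Perm (c :: t.erase a) :=
        (hp.symm.trans ((htw.cons c).trans (.swap _ _ _))).cons_inv
      have hw : Feasible S (t.erase a) := hl.2.sublist hS List.erase_sublist
      have haw : a ∈ S (c :: t.erase a : List ι) := Multiset.coe_eq_coe.2 htw' ▸ hl'.1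
      have hcw : c ∈ S (a :: t.erase a : List ι) := Multiset.coe_eq_coe.2 htw ▸ hl.1
      have hfa : Feasible S (a :: t.erase a) :=
        ⟨hS (List.sublist_cons_self _ _).subperm haw, hw⟩
      have hfc : Feasible S (c :: t.erase a) :=
        ⟨hS (List.sublist_cons_self _ _).subperm hcw, hw⟩
      have hlen : t'.length = t.length := by
        simpa using hp.length_eq.symm
      have h₁ := (FeasibleSwap.reflTransGen_cons hl.1
        (Feasible.reflTransGen hS htw hl.2 hfa)).1
      have h₂ := (FeasibleSwap.reflTransGen_cons haw
        (Feasible.reflTransGen hS htw'.symm hfc hl'.2)).1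
      exact (h₁.tail ⟨.swap _ _ _, haw, hfc⟩).trans h₂
termination_by l => l.length
decreasing_by
  all_goals simp_all [List.length_erase_of_mem]
  all_goals have := List.length_pos_of_mem hat
  all_goals omega

lemma Relation.ReflTransGen.exists_seq {α : Type*} {R : α → α → Prop} {a c : α}
    (h : Relation.ReflTransGen R a c) :
    ∃ (r : ℕ) (f : ℕ → α), f 0 = a ∧ f r = c ∧ ∀ s < r, R (f s) (f (s + 1)) := by
  induction h with
  | refl => exact ⟨0, fun _ => a, rfl, rfl, by simp⟩
  | @tail x y _ hxy ih =>
    obtain ⟨r, f, h0, hr, hf⟩ := ih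
    refine ⟨r + 1, fun s => if s ≤ r then f s else y, by simpa using h0, by simp, fun s hs => ?_⟩
    rcases (Nat.lt_succ_iff.1 hs).eq_or_lt with rfl | hlt
    · simpa [hr] using hxy
    · simpa [hlt.le, Nat.succ_le_of_lt hlt] using hf s hlt

end Feasible

section Words

variable {ι : Type*}

/-- The word `σ (p-1), …, σ 0`. -/
def wordOf (σ : ℕ → ι) : ℕ → List ι
  | 0 => []
  | p + 1 => σ p :: wordOf σ p

/-- The function whose values at `0, …, p-1` are the letters of a word of length `p` read from
right to left, and which agrees with `d` afterwards. -/
def seqOf (d : ℕ → ι) : List ι → ℕ → ι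
  | [], i => d i
  | a :: l, i => if i = l.length then a else seqOf d l i

@[simp] lemma length_wordOf (σ : ℕ → ι) (p : ℕ) : (wordOf σ p).length = p := by
  induction p with
  | zero => rfl
  | succ p ih => simp [wordOf, ih]

lemma mem_wordOf {σ : ℕ → ι} {p : ℕ} {a : ι} : a ∈ wordOf σ p ↔ ∃ i < p, σ i = a := by
  induction p with
  | zero => simp [wordOf]
  | succ p ih => simp only [wordOf, List.mem_cons, ih, Nat.exists_lt_succ_right, or_comm, eq_comm]

lemma nodup_wordOf {σ : ℕ → ι} {p : ℕ} : (wordOf σ p).Nodup ↔ Set.InjOn σ (Set.Iio p) := by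
  induction p with
  | zero => simp [wordOf]
  | succ p ih =>
    rw [wordOf, List.nodup_cons, ih, mem_wordOf, ← Order.succ_eq_add_one, Order.Iio_succ,
      ← Set.Iio_insert, Set.injOn_insert (by simp), and_comm]
    rfl

lemma wordOf_congr {σ τ : ℕ → ι} {p : ℕ} (h : ∀ i < p, σ i = τ i) : wordOf σ p = wordOf τ p := by
  induction p with
  | zero => rfl
  | succ p ih => rw [wordOf, wordOf, h p (by simp), ih fun i hi => h i (by omega)]

lemma wordOf_seqOf (d : ℕ → ι) (l : List ι) : wordOf (seqOf d l) l.length = l := by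
  induction l with
  | nil => rfl
  | cons a l ih =>
    simp only [List.length_cons, wordOf, seqOf, if_true]
    congr 1
    exact (wordOf_congr fun i hi => if_neg hi.ne).trans ih

lemma seqOf_wordOf (d σ : ℕ → ι) {p i : ℕ} (hi : i < p) : seqOf d (wordOf σ p) i = σ i := by
  induction p with
  | zero => omega
  | succ p ih =>
    rw [wordOf, seqOf, length_wordOf]
    split_ifs with h
    · rw [h]
    · exact ih (by omega)

lemma AdjSwap.exists_seqOf_eq_swap (d : ℕ → ι) {l l' : List ι} (h : AdjSwap l l') :
    ∃ q, q + 1 < l.length ∧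
      ∀ i < l.length, seqOf d l' i = seqOf d l (Equiv.swap q (q + 1) i) := by
  induction h with
  | swap a b l =>
    refine ⟨l.length, by simp, fun i hi => ?_⟩
    simp only [List.length_cons] at hi
    rcases lt_trichotomy i l.length with h | rfl | h
    · rw [Equiv.swap_apply_of_ne_of_ne (by omega) (by omega)]
      simp [seqOf, h.ne, (h.trans (Nat.lt_succ_self _)).ne]
    · simp [seqOf]
    · obtain rfl : i = l.length + 1 := by omega
      simp [seqOf]
  | @cons a l l' h ih =>
    obtain ⟨q, hq, hi⟩ := ih
    have hlen := h.perm.length_eq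
    refine ⟨q, by simp only [List.length_cons]; omega, fun i hil => ?_⟩
    simp only [List.length_cons] at hil
    simp only [seqOf, ← hlen]
    rcases (Nat.lt_succ_iff.1 hil).eq_or_lt with rfl | hlt
    · rw [Equiv.swap_apply_of_ne_of_ne (by omega) (by omega)]
      simp
    · have : Equiv.swap q (q + 1) i ≠ l.length := by
        rw [Equiv.swap_apply_def]
        split_ifs <;> omega
      rw [if_neg hlt.ne, if_neg this, hi i hlt]

lemma feasible_wordOf {S : Multiset ι → Set ι} {σ : ℕ → ι} {p : ℕ} :
    Feasible S (wordOf σ p) ↔ ∀ i < p, σ i ∈ S (wordOf σ i) := by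
  induction p with
  | zero => simp [wordOf, Feasible]
  | succ p ih => rw [wordOf, Feasible, ih, Nat.forall_lt_succ_right, and_comm]

end Words

section Chains

variable {K : Type*} [Field K] {n k : ℕ} {m : Fin k → (Fin n →₀ ℕ)} {b : (Fin n →₀ ℕ) → Fin k}

lemma permOf_iff {σ : ℕ → Fin n} {p : ℕ} {α : Finset (Fin n)} :
    PermOf σ p α ↔ (wordOf σ p).Perm α.toList := by
  rw [PermOf, ← nodup_wordOf]
  simp only [← mem_wordOf]
  constructor
  · rintro ⟨h, hα⟩
    exact (List.perm_ext_iff_of_nodup h α.nodup_toList).2 fun a => by simp [hα]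
  · intro h
    exact ⟨h.nodup_iff.2 α.nodup_toList, fun a => by rw [h.mem_iff, Finset.mem_toList]⟩

/-- The index of the generator `b(x_M · u)`, where `x_M` is the product of the variables in `M`. -/
noncomputable def vertexIndex (b : (Fin n →₀ ℕ) → Fin k) (u : Fin n →₀ ℕ)
    (M : Multiset (Fin n)) : Fin k :=
  b (u + (M.map fun a => Finsupp.single a 1).sum)

lemma vertexIndex_cons (hb : IsDecompositionFunction K m b) (hlq : HasLinearQuotients K m)
    (hreg : IsRegularDecomp K m b) (j : Fin k) (a : Fin n) (M : Multiset (Fin n)) :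
    vertexIndex b (m j) (a ::ₘ M) =
      b (m (vertexIndex b (m j) M) + Finsupp.single a 1) := by
  rw [vertexIndex, Multiset.map_cons, Multiset.sum_cons, add_comm (Finsupp.single a 1),
    ← add_assoc]
  exact hb.add_single hlq hreg le_self_add a

lemma antitone_mset_vertexIndex (hb : IsDecompositionFunction K m b)
    (hlq : HasLinearQuotients K m) (hreg : IsRegularDecomp K m b) (j : Fin k) :
    Antitone fun M => mset K m (vertexIndex b (m j) M) := by
  intro M M' h
  obtain ⟨N, rfl⟩ := Multiset.le_iff_exists_add.1 h
  clear h
  induction N using Multiset.induction with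
  | empty => simp
  | cons a N ih =>
    rw [Multiset.add_cons]
    simp only [vertexIndex_cons hb hlq hreg]
    exact (hb.mset_subset hlq hreg _ _).trans ih

lemma chainSeq_eq (hmin : MinimalGens m) (hb : IsDecompositionFunction K m b)
    (hlq : HasLinearQuotients K m) (hreg : IsRegularDecomp K m b) (j : Fin k)
    (σ : ℕ → Fin n) (i : ℕ) :
    chainSeq m b (m j) σ i = m (vertexIndex b (m j) (wordOf σ i)) := by
  induction i with
  | zero =>
    have : b (m j) = j := hmin _ _ (hb.spec le_rfl).1
    simp [chainSeq, wordOf, vertexIndex, this]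
  | succ i ih =>
    rw [chainSeq, ih, wordOf, ← Multiset.cons_coe, vertexIndex_cons hb hlq hreg]

lemma nondeg_iff_feasible (hmin : MinimalGens m) (hb : IsDecompositionFunction K m b)
    (hlq : HasLinearQuotients K m) (hreg : IsRegularDecomp K m b) (j : Fin k)
    (σ : ℕ → Fin n) (p : ℕ) :
    Nondeg m b (m j) σ p ↔
      Feasible (fun M => mset K m (vertexIndex b (m j) M)) (wordOf σ p) := by
  rw [feasible_wordOf]
  have step : ∀ i, vertexIndex b (m j) (wordOf σ (i + 1)) =
      b (m (vertexIndex b (m j) (wordOf σ i)) + Finsupp.single (σ i) 1) := fun i => by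
    rw [wordOf, ← Multiset.cons_coe, vertexIndex_cons hb hlq hreg]
  constructor
  · intro h i hi
    by_contra hmem
    have := h (Set.mem_Iic.2 (Nat.succ_le_of_lt hi)) (Set.mem_Iic.2 hi.le) (by
      rw [chainSeq_eq hmin hb hlq hreg, chainSeq_eq hmin hb hlq hreg, step,
        hb.eq_of_notMem_mset hlq hmem])
    omega
  · intro h
    have anti : StrictAntiOn (fun i => vertexIndex b (m j) (wordOf σ i)) (Set.Iic p) := by
      refine strictAntiOn_of_succ_lt Set.ordConnected_Iic fun i _ _ hi => ?_
      rw [Order.succ_eq_add_one] at hi ⊢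
      simp only [step]
      exact (hb.lt_iff_mem_mset hlq).2 (h i (by simpa using hi))
    intro x hx y hy hxy
    rw [chainSeq_eq hmin hb hlq hreg, chainSeq_eq hmin hb hlq hreg] at hxy
    exact anti.injOn hx hy (hmin _ _ hxy.le)

end Chains

/-- any two permutations `σ, σ'` of `α` with nondegenerate chains are
connected by a finite sequence of permutations of `α`, all with nondegenerate chains,
in which consecutive permutations differ by transposing two adjacent entries. -/
theorem stmt7 (K : Type*) [Field K] {n k : ℕ} (m : Fin k → (Fin n →₀ ℕ))
    (hmin : MinimalGens m) (hlq : HasLinearQuotients K m)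
    (b : (Fin n →₀ ℕ) → Fin k) (hb : IsDecompositionFunction K m b)
    (hreg : IsRegularDecomp K m b)
    (j : Fin k) (α : Finset (Fin n)) (hα : ↑α ⊆ mset K m j)
    (p : ℕ) (hcard : α.card = p)
    (σ σ' : ℕ → Fin n) (hσ : PermOf σ p α) (hσ' : PermOf σ' p α)
    (hnd : Nondeg m b (m j) σ p) (hnd' : Nondeg m b (m j) σ' p) :
    ∃ (r : ℕ) (τ : ℕ → (ℕ → Fin n)),
      (∀ i < p, τ 0 i = σ i) ∧
      (∀ i < p, τ r i = σ' i) ∧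
      (∀ s ≤ r, PermOf (τ s) p α ∧ Nondeg m b (m j) (τ s) p) ∧
      (∀ s < r, ∃ q : ℕ, q + 1 < p ∧
        ∀ i < p, τ (s + 1) i = τ s (Equiv.swap q (q + 1) i)) := by
  have nondeg_iff := nondeg_iff_feasible hmin hb hlq hreg j
  set S := fun M => mset K m (vertexIndex b (m j) M)
  have hS : Antitone S := antitone_mset_vertexIndex hb hlq hreg j
  have hf : Feasible S (wordOf σ p) := (nondeg_iff σ p).1 hnd
  have hp := permOf_iff.1 hσ
  obtain ⟨r, f, h0, hr, hstep⟩ := (hf.reflTransGen hS (hp.trans (permOf_iff.1 hσ').symm)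
    ((nondeg_iff σ' p).1 hnd')).exists_seq
  have inv : ∀ s ≤ r, (f s).Perm α.toList ∧ Feasible S (f s) := by
    intro s
    induction s with
    | zero => exact fun _ => h0 ▸ ⟨hp, hf⟩
    | succ s ih =>
      intro hs
      exact ⟨(hstep s hs).1.perm.symm.trans (ih (by omega)).1, (hstep s hs).2⟩
  have hlen : ∀ s ≤ r, (f s).length = p := fun s hs => by
    rw [(inv s hs).1.length_eq, Finset.length_toList, hcard]
  refine ⟨r, fun s => seqOf σ (f s), fun i hi => ?_, fun i hi => ?_, fun s hs => ?_,
    fun s hs => ?_⟩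
  · simp only [h0, seqOf_wordOf σ σ hi]
  · simp only [hr, seqOf_wordOf σ σ' hi]
  · have hw : wordOf (seqOf σ (f s)) p = f s := by
      rw [← hlen s hs, wordOf_seqOf]
    rw [permOf_iff, nondeg_iff, hw]
    exact inv s hs
  · have := (hstep s hs).1.exists_seqOf_eq_swap σ
    rwa [hlen s hs.le] at this
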